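/- arXiv:1405.1858 — 2 statements merged into one kernel-verified Lean document; each statement's English description precedes it below -/
import Mathlib

section
/- Let Φ : ℝ^d → ℝ^d be a Lipschitz map and let M be a d×d real matrix such that for every sequence ε_n → 0⁺ the rescaled derivatives DΦ(·/ε_n) converge to the constant matrix M in the weak-* sense in L^∞: for every h ∈ L¹(ℝ^d) and all indices i, j, ∫_{ℝ^d} h(x) (DΦ(x/ε_n))_{ij} dx → (∫_{ℝ^d} h dx) · M_{ij} as n → ∞, where DΦ denotes the (almost everywhere defined) Fréchet derivative of Φ. Then the rescaled maps x ↦ ε Φ(x/ε) converge to the linear map x ↦ Mx uniformly on every compact subset of ℝ^d as ε → 0⁺. -/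
open MeasureTheory Metric Filter Topology

lemma LipschitzWith.norm_fderiv_apply_le {E : Type*} [NormedAddCommGroup E] [NormedSpace ℝ E]
    {C : NNReal} {u : E → ℝ} (hu : LipschitzWith C u) (x v : E) :
    ‖fderiv ℝ u x v‖ ≤ C * ‖v‖ :=
  (fderiv ℝ u x).le_of_opNorm_le (norm_fderiv_le_of_lipschitz ℝ hu) v

lemma LipschitzWith.integrable_mul_fderiv_apply {E : Type*} [NormedAddCommGroup E]
    [NormedSpace ℝ E] [MeasurableSpace E] [OpensMeasurableSpace E] {μ : Measure E}
    {C : NNReal} {u h : E → ℝ} (hu : LipschitzWith C u) (hh : Integrable h μ)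
    (v : E) : Integrable (fun x => h x * fderiv ℝ u x v) μ :=
  hh.mul_bdd (c := C * ‖v‖) (measurable_fderiv_apply_const ℝ u v).aestronglyMeasurable
    (.of_forall fun x => hu.norm_fderiv_apply_le x v)

section WeakDerivative

variable {E : Type*} [NormedAddCommGroup E] [NormedSpace ℝ E] [FiniteDimensional ℝ E]
  [MeasurableSpace E] [BorelSpace E] {μ : Measure E} [μ.IsAddHaarMeasure]
  {C : NNReal} {u : E → ℝ} {h : E → ℝ}

lemma LipschitzWith.hasDerivAt_integral_mul_translate_sub (hu : LipschitzWith C u)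
    (hh : Integrable h μ) (v : E) (t : ℝ) :
    HasDerivAt (fun s : ℝ => ∫ z, h z * (u (z + s • v) - u z) ∂μ)
      (∫ z, h z * fderiv ℝ u (z + t • v) v ∂μ) t := by
  have hmeas (s : ℝ) : AEStronglyMeasurable (fun z => h z * (u (z + s • v) - u z)) μ := by
    refine hh.aestronglyMeasurable.mul (Continuous.aestronglyMeasurable ?_)
    have := hu.continuous
    fun_prop
  refine (hasDerivAt_integral_of_dominated_loc_of_lip (bound := fun z => ‖h z‖ * (C * ‖v‖))
    univ_mem (.of_forall hmeas) ?_ ?_ ?_ (hh.norm.mul_const _) ?_).2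
  · refine hh.mul_bdd (c := C * ‖t • v‖) ?_ (.of_forall fun z => ?_)
    · refine Continuous.aestronglyMeasurable ?_
      have := hu.continuous
      fun_prop
    · simpa using hu.norm_sub_le (z + t • v) z
  · refine hh.aestronglyMeasurable.mul (Measurable.aestronglyMeasurable ?_)
    exact (measurable_fderiv_apply_const ℝ u v).comp (measurable_add_const (t • v))
  · refine .of_forall fun z => LipschitzOnWith.of_dist_le_mul fun a _ b _ => ?_
    have hab := hu.norm_sub_le (z + a • v) (z + b • v)
    rw [add_sub_add_left_eq_sub, ← sub_smul, norm_smul] at hab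
    have e : h z * (u (z + a • v) - u z) - h z * (u (z + b • v) - u z)
        = h z * (u (z + a • v) - u (z + b • v)) := by ring
    rw [Real.dist_eq, Real.dist_eq, ← Real.norm_eq_abs, e, norm_mul, Real.coe_nnabs,
      abs_of_nonneg (by positivity)]
    calc ‖h z‖ * ‖u (z + a • v) - u (z + b • v)‖ ≤ ‖h z‖ * (C * (‖a - b‖ * ‖v‖)) := by gcongr
      _ = ‖h z‖ * (C * ‖v‖) * |a - b| := by rw [Real.norm_eq_abs (a - b)]; ring
  · have hae : ∀ᵐ z ∂μ, DifferentiableAt ℝ u (z + t • v) :=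
      (measurePreserving_add_right μ (t • v)).quasiMeasurePreserving.ae hu.ae_differentiableAt
    filter_upwards [hae] with z hz
    have hline : HasDerivAt (fun s : ℝ => z + s • v) v t := by
      simpa using ((hasDerivAt_id t).smul_const v).const_add z
    exact ((hz.hasFDerivAt.comp_hasDerivAt t hline).sub_const (u z)).const_mul (h z)

lemma LipschitzWith.integral_mul_translate_sub (hu : LipschitzWith C u)
    (hh : Integrable h μ) (v : E) :
    IntervalIntegrable (fun t : ℝ => ∫ z, h (z - t • v) * fderiv ℝ u z v ∂μ) volume 0 1 ∧
    ∫ z, h z * (u (z + v) - u z) ∂μ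
      = ∫ t in (0 : ℝ)..1, ∫ z, h (z - t • v) * fderiv ℝ u z v ∂μ := by
  have htrans (t : ℝ) : ∫ z, h z * fderiv ℝ u (z + t • v) v ∂μ
      = ∫ z, h (z - t • v) * fderiv ℝ u z v ∂μ := by
    rw [← integral_add_right_eq_self (fun z => h (z - t • v) * fderiv ℝ u z v) (t • v)]
    simp
  have hderiv (t : ℝ) := htrans t ▸ hu.hasDerivAt_integral_mul_translate_sub hh v t
  have hint : IntervalIntegrable (fun t : ℝ => ∫ z, h (z - t • v) * fderiv ℝ u z v ∂μ)
      volume 0 1 := by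
    refine (intervalIntegrable_const (c := (∫ z, ‖h z‖ ∂μ) * (C * ‖v‖))).mono_fun ?_
      (.of_forall fun t => ?_)
    · rw [← funext fun t => (hderiv t).deriv]
      exact (measurable_deriv _).aestronglyMeasurable
    · refine le_trans ?_ (le_abs_self _)
      rw [← integral_mul_const, ← integral_sub_right_eq_self (fun z => ‖h z‖ * (C * ‖v‖)) (t • v)]
      refine norm_integral_le_of_norm_le ((hh.comp_sub_right (t • v)).norm.mul_const _)
        (.of_forall fun z => ?_)
      rw [norm_mul]
      gcongr
      exact hu.norm_fderiv_apply_le z v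
  refine ⟨hint, ?_⟩
  rw [intervalIntegral.integral_eq_sub_of_hasDerivAt (fun t _ => hderiv t) hint]
  simp

/-- If the directional derivatives of uniformly Lipschitz functions converge weak-* to a constant,
then so do the corresponding increments. -/
lemma tendsto_integral_mul_translate_sub {u : ℕ → E → ℝ} (hu : ∀ n, LipschitzWith C (u n))
    {v : E} {c : ℝ}
    (hweak : ∀ h : E → ℝ, Integrable h μ →
      Tendsto (fun n => ∫ z, h z * fderiv ℝ (u n) z v ∂μ) atTop (𝓝 ((∫ z, h z ∂μ) * c)))
    (hh : Integrable h μ) :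
    Tendsto (fun n => ∫ z, h z * (u n (z + v) - u n z) ∂μ) atTop (𝓝 ((∫ z, h z ∂μ) * c)) := by
  simp_rw [fun n => ((hu n).integral_mul_translate_sub hh v).2]
  have hlim : ∫ _ in (0 : ℝ)..1, (∫ z, h z ∂μ) * c = (∫ z, h z ∂μ) * c := by simp
  rw [← hlim]
  refine intervalIntegral.tendsto_integral_filter_of_dominated_convergence
    (fun _ => (∫ z, ‖h z‖ ∂μ) * (C * ‖v‖)) (.of_forall fun n => ?_) (.of_forall fun n => ?_)
    intervalIntegrable_const (.of_forall fun t _ => ?_)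
  · exact ((hu n).integral_mul_translate_sub hh v).1.def'.aestronglyMeasurable
  · refine .of_forall fun t _ => ?_
    rw [← integral_mul_const, ← integral_sub_right_eq_self (fun z => ‖h z‖ * (C * ‖v‖)) (t • v)]
    refine norm_integral_le_of_norm_le ((hh.comp_sub_right (t • v)).norm.mul_const _)
      (.of_forall fun z => ?_)
    rw [norm_mul]
    gcongr
    exact (hu n).norm_fderiv_apply_le z v
  · simpa only [integral_sub_right_eq_self h (t • v)] using
      hweak (fun z => h (z - t • v)) (hh.comp_sub_right (t • v))

lemma LipschitzWith.abs_setIntegral_translate_sub_sub_le (hu : LipschitzWith C u) (v : E) (r : ℝ) :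
    |∫ z in ball 0 r, (u (z + v) - u z) ∂μ - μ.real (ball 0 r) * (u v - u 0)|
      ≤ 2 * C * r * μ.real (ball 0 r) := by
  have hconst : μ.real (ball 0 r) * (u v - u 0) = ∫ z in ball (0 : E) r, (u v - u 0) ∂μ := by
    simp
  have hint : IntegrableOn (fun z => u (z + v) - u z) (ball 0 r) μ := by
    have := hu.continuous
    exact (ContinuousOn.integrableOn_compact (isCompact_closedBall 0 r)
      (by fun_prop : Continuous _).continuousOn).mono_set ball_subset_closedBall
  rw [hconst, ← integral_sub hint (integrableOn_const measure_ball_lt_top.ne), ← Real.norm_eq_abs]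
  refine norm_setIntegral_le_of_norm_le_const measure_ball_lt_top fun z hz => ?_
  have h1 := hu.norm_sub_le (z + v) v
  have h2 := hu.norm_sub_le z 0
  have hz' : ‖z‖ ≤ r := (mem_ball_zero_iff.1 hz).le
  have h3 : C * ‖z‖ ≤ C * r := by gcongr
  rw [add_sub_cancel_right] at h1
  rw [sub_zero] at h2
  calc ‖u (z + v) - u z - (u v - u 0)‖ = ‖(u (z + v) - u v) - (u z - u 0)‖ := by congr 1; ring
    _ ≤ ‖u (z + v) - u v‖ + ‖u z - u 0‖ := _root_.norm_sub_le _ _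
    _ ≤ 2 * C * r := by linarith

lemma tendsto_sub_of_tendsto_integral_mul_fderiv {u : ℕ → E → ℝ}
    (hu : ∀ n, LipschitzWith C (u n)) {v : E} {c : ℝ}
    (hweak : ∀ h : E → ℝ, Integrable h μ →
      Tendsto (fun n => ∫ z, h z * fderiv ℝ (u n) z v ∂μ) atTop (𝓝 ((∫ z, h z ∂μ) * c))) :
    Tendsto (fun n => u n v - u n 0) atTop (𝓝 c) := by
  rw [Metric.tendsto_atTop]
  intro ε hε
  obtain ⟨r, hr, hrε⟩ : ∃ r : ℝ, 0 < r ∧ 2 * C * r < ε / 2 := by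
    refine ⟨ε / (4 * (C + 1)), by positivity, ?_⟩
    have hC : (0 : ℝ) ≤ C := C.2
    rw [mul_div_assoc', div_lt_div_iff₀ (by positivity) (by norm_num)]
    nlinarith
  set m := μ.real (ball 0 r) with hm
  have hm0 : 0 < m := ENNReal.toReal_pos (measure_ball_pos μ 0 hr).ne' measure_ball_lt_top.ne
  have hind : Integrable ((ball (0 : E) r).indicator fun _ => (1 : ℝ)) μ :=
    (integrable_indicator_iff measurableSet_ball).2 (integrableOn_const measure_ball_lt_top.ne)
  have key := tendsto_integral_mul_translate_sub hu hweak hind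
  have hset (n : ℕ) : ∫ z, (ball (0 : E) r).indicator (fun _ => (1 : ℝ)) z
      * (u n (z + v) - u n z) ∂μ = ∫ z in ball 0 r, (u n (z + v) - u n z) ∂μ := by
    rw [← integral_indicator measurableSet_ball]
    congr 1 with z
    by_cases hz : z ∈ ball (0 : E) r <;> simp [hz]
  simp_rw [hset, integral_indicator_const _ measurableSet_ball, smul_eq_mul, mul_one] at key
  obtain ⟨N, hN⟩ := Metric.tendsto_atTop.1 key (m * (ε / 2)) (by positivity)
  refine ⟨N, fun n hn => ?_⟩
  have h1 := hN n hn
  have h2 := (hu n).abs_setIntegral_translate_sub_sub_le (μ := μ) v r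
  rw [← hm] at h1 h2
  rw [Real.dist_eq] at h1 ⊢
  have h3 : m * |u n v - u n 0 - c| < m * ε := by
    rw [← abs_of_pos hm0, ← abs_mul, abs_of_pos hm0]
    rw [abs_lt] at h1 ⊢
    rw [abs_le] at h2
    have := mul_lt_mul_of_pos_right hrε hm0
    constructor <;> linarith
  exact lt_of_mul_lt_mul_left h3 hm0.le

end WeakDerivative

lemma LipschitzWith.rescale {E F : Type*} [NormedAddCommGroup E] [NormedSpace ℝ E]
    [NormedAddCommGroup F] [NormedSpace ℝ F] {K : NNReal} {f : E → F} (hf : LipschitzWith K f)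
    (ε : ℝ) : LipschitzWith K (fun x => ε • f (ε⁻¹ • x)) := by
  refine LipschitzWith.of_dist_le_mul fun x y => ?_
  rcases eq_or_ne ε 0 with rfl | hε
  · simp; positivity
  · have h1 := hf.dist_le_mul (ε⁻¹ • x) (ε⁻¹ • y)
    rw [dist_smul₀] at h1 ⊢
    calc ‖ε‖ * dist (f (ε⁻¹ • x)) (f (ε⁻¹ • y)) ≤ ‖ε‖ * (K * (‖ε⁻¹‖ * dist x y)) := by gcongr
      _ = K * dist x y := by
        rw [norm_inv]
        field_simp [norm_ne_zero_iff.2 hε]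

lemma Equicontinuous.tendstoUniformlyOn_of_tendsto {X ι α : Type*} [TopologicalSpace X]
    [UniformSpace α] {F : ι → X → α} (hF : Equicontinuous F) {l : Filter ι} {f : X → α}
    (hlim : ∀ x, Tendsto (fun i => F i x) l (𝓝 (f x))) {K : Set X} (hK : IsCompact K) :
    TendstoUniformlyOn F f l K := by
  have := isCompact_iff_compactSpace.1 hK
  rw [tendstoUniformlyOn_iff_tendstoUniformly_comp_coe]
  exact UniformFun.tendsto_iff_tendstoUniformly.1 <| (((equicontinuous_restrict_iff _).2 (hF.equicontinuousOn K)).tendsto_uniformFun_iff_pi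
    l _).2 (tendsto_pi_nhds.2 fun x => hlim x)

/-- Deterministic version of Lemma 1(ii): if `Φ : ℝ^d → ℝ^d` is Lipschitz and the rescaled
derivatives `DΦ(·/εₙ)` converge weak-* in `L^∞` to a constant matrix `M` for every sequence
`εₙ → 0⁺`, then `x ↦ ε Φ(x/ε)` converges to `x ↦ M x` uniformly on compacts as `ε → 0⁺`. -/
theorem stmt_6 (d : ℕ) (Φ : EuclideanSpace ℝ (Fin d) → EuclideanSpace ℝ (Fin d))
    (hΦ_lip : ∃ K : NNReal, LipschitzWith K Φ)
    (M : Matrix (Fin d) (Fin d) ℝ)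
    (hweak : ∀ ε : ℕ → ℝ, (∀ n, 0 < ε n) → Tendsto ε atTop (𝓝 0) →
      ∀ h : EuclideanSpace ℝ (Fin d) → ℝ, Integrable h → ∀ i j : Fin d,
        Tendsto
          (fun n => ∫ x, h x * (fderiv ℝ Φ ((ε n)⁻¹ • x) (EuclideanSpace.single j 1) i))
          atTop (𝓝 ((∫ x, h x) * M i j))) :
    ∀ K : Set (EuclideanSpace ℝ (Fin d)), IsCompact K →
      TendstoUniformlyOn (fun (ε : ℝ) (x : EuclideanSpace ℝ (Fin d)) => ε • Φ (ε⁻¹ • x))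
        (fun x => Matrix.toEuclideanLin M x) (𝓝[>] (0 : ℝ)) K := by
  obtain ⟨L, hL⟩ := hΦ_lip
  intro K hK
  refine Equicontinuous.tendstoUniformlyOn_of_tendsto
    (LipschitzWith.uniformEquicontinuous _ L hL.rescale).equicontinuous (fun x => ?_) hK
  refine tendsto_of_seq_tendsto fun e he => ?_
  obtain ⟨he0, hepos⟩ := tendsto_nhdsWithin_iff.1 he
  obtain ⟨N, hN⟩ := eventually_atTop.1 hepos
  refine (tendsto_add_atTop_iff_nat N).1 ?_
  set ε : ℕ → ℝ := fun n => e (n + N) with hε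
  have hεpos (n : ℕ) : 0 < ε n := hN _ (Nat.le_add_left _ _)
  have hε0 : Tendsto ε atTop (𝓝 0) := (tendsto_add_atTop_iff_nat N).2 he0
  change Tendsto (fun n => ε n • Φ ((ε n)⁻¹ • x)) atTop _
  rw [(PiLp.homeomorph 2 fun _ : Fin d => ℝ).isInducing.tendsto_nhds_iff, tendsto_pi_nhds]
  intro i
  set u : ℕ → EuclideanSpace ℝ (Fin d) → ℝ := fun n y => (ε n • Φ ((ε n)⁻¹ • y)) i with hu
  have hulip (n : ℕ) : LipschitzWith L (u n) := by
    refine LipschitzWith.of_dist_le_mul fun y z => le_trans ?_ ((hL.rescale (ε n)).dist_le_mul y z)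
    rw [dist_eq_norm, dist_eq_norm]
    exact PiLp.norm_apply_le (ε n • Φ ((ε n)⁻¹ • y) - ε n • Φ ((ε n)⁻¹ • z)) i
  have hfderiv (n : ℕ) : ∀ᵐ y, ∀ v,
      fderiv ℝ (u n) y v = fderiv ℝ Φ ((ε n)⁻¹ • y) v i := by
    have hae : ∀ᵐ y, DifferentiableAt ℝ Φ ((ε n)⁻¹ • y) :=
      (Measure.quasiMeasurePreserving_smul volume (inv_ne_zero (hεpos n).ne')).ae
        hL.ae_differentiableAt
    filter_upwards [hae] with y hy v
    have hs : HasFDerivAt (fun y : EuclideanSpace ℝ (Fin d) => (ε n)⁻¹ • y)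
        ((ε n)⁻¹ • ContinuousLinearMap.id ℝ _) y := (hasFDerivAt_id y).fun_const_smul _
    have h1 := (EuclideanSpace.proj (𝕜 := ℝ) i).hasFDerivAt.comp y
      ((hy.hasFDerivAt.comp y hs).const_smul (ε n))
    have h2 : HasFDerivAt (u n) _ y := h1
    rw [h2.fderiv]
    simp [(hεpos n).ne']
  have hw (h : EuclideanSpace ℝ (Fin d) → ℝ) (hh : Integrable h) :
      Tendsto (fun n => ∫ z, h z * fderiv ℝ (u n) z x) atTop
        (𝓝 ((∫ z, h z) * Matrix.toEuclideanLin M x i)) := by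
    have hx : x = ∑ j, x j • EuclideanSpace.single j (1 : ℝ) := by
      ext k
      simp [Finset.sum_apply, Pi.single_apply]
    have hsum (n : ℕ) : ∫ z, h z * fderiv ℝ (u n) z x
        = ∑ j, x j * ∫ z, h z * (fderiv ℝ Φ ((ε n)⁻¹ • z) (EuclideanSpace.single j 1) i) := by
      have (j : Fin d) : ∫ z, h z * (fderiv ℝ Φ ((ε n)⁻¹ • z) (EuclideanSpace.single j 1) i)
          = ∫ z, h z * fderiv ℝ (u n) z (EuclideanSpace.single j 1) :=
        integral_congr_ae ((hfderiv n).mono fun z hz => by simp only [hz])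
      simp_rw [this, ← integral_const_mul]
      rw [← integral_finsetSum _ fun j _ =>
        ((hulip n).integrable_mul_fderiv_apply hh _).const_mul _]
      congr 1 with z
      conv_lhs => rw [hx]
      simp only [map_sum, map_smul, smul_eq_mul, Finset.mul_sum]
      exact Finset.sum_congr rfl fun j _ => by ring
    have hlim : (∫ z, h z) * Matrix.toEuclideanLin M x i = ∑ j, x j * ((∫ z, h z) * M i j) := by
      simp only [Matrix.toEuclideanLin, Matrix.toLpLin_apply, Matrix.mulVec, dotProduct, Finset.mul_sum]
      exact Finset.sum_congr rfl fun j _ => by ring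
    simp_rw [hsum, hlim]
    exact tendsto_finsetSum _ fun j _ => (hweak ε hεpos hε0 h hh i j).const_mul _
  have hmain := tendsto_sub_of_tendsto_integral_mul_fderiv hulip hw
  have hzero : Tendsto (fun n => u n 0) atTop (𝓝 0) := by
    simpa [hu] using hε0.mul_const (Φ 0 i)
  have hsum := hmain.add hzero
  simp only [sub_add_cancel, add_zero] at hsum
  exact hsum
end

section
/- Let Φ : ℝ^d → ℝ^d be a bijection such that Φ and Φ⁻¹ are Lipschitz, and let M be an invertible d×d real matrix such that ε Φ(x/ε) → Mx uniformly on compact subsets of ℝ^d as ε → 0⁺. Let g : ℝ^d → ℝ be bounded and measurable, and let c ∈ ℝ be such that the functions x ↦ g(x/ε) |det DΦ(x/ε)| converge to the constant c in the weak-* sense in L^∞(ℝ^d) as ε → 0⁺ (DΦ being the a.e.-defined derivative of Φ). Then the functions x ↦ g(Φ⁻¹(x/ε)) converge in the weak-* sense in L^∞(ℝ^d) to the constant c / |det M|: for every h ∈ L¹(ℝ^d), ∫_{ℝ^d} g(Φ⁻¹(x/ε)) h(x) dx → (c / |det M|) ∫_{ℝ^d} h(x) dx as ε → 0⁺. -/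
open MeasureTheory Metric Filter Topology

/-- A Lipschitz self-map of a finite-dimensional space maps null sets to null sets. -/
theorem LipschitzWith.addHaar_image_eq_zero {E : Type*} [NormedAddCommGroup E] [NormedSpace ℝ E]
    [FiniteDimensional ℝ E] [MeasurableSpace E] [BorelSpace E] (μ : Measure E)
    [μ.IsAddHaarMeasure] {K : NNReal} {f : E → E} (hf : LipschitzWith K f) {s : Set E}
    (hs : μ s = 0) : μ (f '' s) = 0 := by
  set ν : Measure E := Measure.hausdorffMeasure (Module.finrank ℝ E)
  refine Measure.absolutelyContinuous_isAddHaarMeasure μ ν (nonpos_iff_eq_zero.1 ?_)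
  calc ν (f '' s) ≤ (K : ENNReal) ^ (Module.finrank ℝ E : ℝ) * ν s :=
        hf.hausdorffMeasure_image_le (Nat.cast_nonneg _) s
    _ = 0 := by rw [Measure.absolutelyContinuous_isAddHaarMeasure ν μ hs, mul_zero]

/-- Change of variables for bijective Lipschitz maps. -/
theorem LipschitzWith.integral_eq_integral_abs_det_fderiv_mul {E : Type*} [NormedAddCommGroup E]
    [NormedSpace ℝ E] [FiniteDimensional ℝ E] [MeasurableSpace E] [BorelSpace E] (μ : Measure E)
    [μ.IsAddHaarMeasure] {K : NNReal} {f : E → E} (hf : LipschitzWith K f)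
    (hbij : Function.Bijective f) (F : E → ℝ) :
    ∫ y, F y ∂μ = ∫ x, |(fderiv ℝ f x).det| * F (f x) ∂μ := by
  set s := {x | DifferentiableAt ℝ f x}
  have hs : μ sᶜ = 0 := hf.ae_differentiableAt
  have himage : (f '' s) =ᵐ[μ] Set.univ := by
    rw [ae_eq_univ, ← Set.image_compl_eq hbij]
    exact hf.addHaar_image_eq_zero μ hs
  rw [← setIntegral_univ, ← setIntegral_congr_set himage,
    integral_image_eq_integral_abs_det_fderiv_smul μ (measurableSet_of_differentiableAt ℝ f)
      (fun x hx => (DifferentiableAt.hasFDerivAt hx).hasFDerivWithinAt) hbij.injective.injOn F,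
    setIntegral_congr_set (ae_eq_univ.2 hs), setIntegral_univ]
  simp only [smul_eq_mul]

/-- The Jacobian determinant of a Lipschitz map is bounded. -/
theorem LipschitzWith.exists_abs_det_fderiv_le {E : Type*} [NormedAddCommGroup E]
    [NormedSpace ℝ E] [FiniteDimensional ℝ E] {K : NNReal} {f : E → E} (hf : LipschitzWith K f) :
    ∃ B : ℝ, 0 ≤ B ∧ ∀ x, |(fderiv ℝ f x).det| ≤ B := by
  have : ProperSpace (E →L[ℝ] E) := FiniteDimensional.proper_real _
  obtain ⟨B, hB⟩ := (isCompact_closedBall (0 : E →L[ℝ] E) K).exists_bound_of_continuousOn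
    (f := fun A : E →L[ℝ] E => A.det) ContinuousLinearMap.continuous_det.continuousOn
  have hB' : ∀ x, |(fderiv ℝ f x).det| ≤ B := fun x => hB _ <| by
    rw [mem_closedBall_zero_iff]
    exact norm_fderiv_le_of_lipschitz ℝ hf
  exact ⟨B, (abs_nonneg _).trans (hB' 0), hB'⟩

/-- Weak-* convergence of a bounded family to a constant can be tested on continuous
compactly supported functions. -/
theorem tendsto_integral_mul_of_forall_hasCompactSupport {X ι : Type*} [TopologicalSpace X]
    [NormalSpace X] [R1Space X] [WeaklyLocallyCompactSpace X] [MeasurableSpace X] [BorelSpace X]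
    {μ : Measure X} [μ.Regular] {l : Filter ι} {F : ι → X → ℝ}
    (hF : ∀ i, AEStronglyMeasurable (F i) μ) {C : ℝ} (hC : ∀ i x, |F i x| ≤ C) {c : ℝ}
    (H : ∀ h : X → ℝ, Continuous h → HasCompactSupport h →
      Tendsto (fun i => ∫ x, F i x * h x ∂μ) l (𝓝 (c * ∫ x, h x ∂μ)))
    {h : X → ℝ} (hh : Integrable h μ) :
    Tendsto (fun i => ∫ x, F i x * h x ∂μ) l (𝓝 (c * ∫ x, h x ∂μ)) := by
  rw [Metric.tendsto_nhds]
  intro ε hε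
  set δ : ℝ := ε / 2 / (|C| + |c| + 1)
  have hpos : 0 < |C| + |c| + 1 := by positivity
  have hδ : 0 < δ := by positivity
  have hδε : (|C| + |c| + 1) * δ = ε / 2 := mul_div_cancel₀ _ hpos.ne'
  obtain ⟨k, hk_supp, hk_close, hk_cont, hk_int⟩ :=
    hh.exists_hasCompactSupport_integral_sub_le hδ
  filter_upwards [Metric.tendsto_nhds.1 (H k hk_cont hk_supp) (ε / 2) (half_pos hε)] with i hi
  have hFC : ∀ᵐ x ∂μ, ‖F i x‖ ≤ C := Eventually.of_forall (hC i)
  have hsub := hh.sub hk_int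
  have h₁ : |∫ x, F i x * (h x - k x) ∂μ| ≤ |C| * δ := by
    calc |∫ x, F i x * (h x - k x) ∂μ| ≤ ∫ x, |C| * ‖h x - k x‖ ∂μ := by
          rw [← Real.norm_eq_abs]
          refine norm_integral_le_of_norm_le (hsub.norm.const_mul _) (Eventually.of_forall ?_)
          intro x
          rw [norm_mul]
          gcongr
          exact (hC i x).trans (le_abs_self C)
      _ ≤ |C| * δ := by
          rw [integral_const_mul]
          gcongr
  have h₂ : |∫ x, (h x - k x) ∂μ| ≤ δ := (norm_integral_le_integral_norm _).trans hk_close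
  have h₃ : |c * ∫ x, (h x - k x) ∂μ| ≤ |c| * δ := by
    rw [abs_mul]
    gcongr
  have e₁ : ∫ x, F i x * (h x - k x) ∂μ = ∫ x, F i x * h x ∂μ - ∫ x, F i x * k x ∂μ := by
    simp_rw [mul_sub]
    exact integral_sub (hh.bdd_mul (hF i) hFC) (hk_int.bdd_mul (hF i) hFC)
  rw [e₁, abs_le] at h₁
  rw [integral_sub hh hk_int, mul_sub, abs_le] at h₃
  rw [Real.dist_eq, abs_lt] at hi ⊢
  constructor <;> linarith [hi.1, hi.2, h₁.1, h₁.2, h₃.1, h₃.2]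

/-- Let the rescalings `ε Φ(x/ε)` of a bi-Lipschitz bijection `Φ` converge pointwise to an
invertible linear map `L`. If `g(x/ε) |det DΦ(x/ε)|` converges weak-* to a constant `c`, then
`g(Φ⁻¹(x/ε))` converges weak-* to `c / |det L|`. -/
theorem tendsto_integral_comp_inverse_mul {E : Type*} [NormedAddCommGroup E]
    [NormedSpace ℝ E] [FiniteDimensional ℝ E] [MeasurableSpace E] [BorelSpace E] (μ : Measure E)
    [μ.IsAddHaarMeasure] {Φ Φinv : E → E} (hleft : Function.LeftInverse Φinv Φ)
    (hright : Function.RightInverse Φinv Φ) {K K' : NNReal} (hΦ : LipschitzWith K Φ)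
    (hΦinv : LipschitzWith K' Φinv) {L : E →L[ℝ] E} (hL : L.det ≠ 0)
    (hconv : ∀ x, Tendsto (fun ε : ℝ => ε • Φ (ε⁻¹ • x)) (𝓝[>] 0) (𝓝 (L x)))
    {g : E → ℝ} (hg : Measurable g) {C : ℝ} (hC : ∀ x, |g x| ≤ C) {c : ℝ}
    (hweak : ∀ h : E → ℝ, Integrable h μ →
      Tendsto (fun ε : ℝ => ∫ x, g (ε⁻¹ • x) * |(fderiv ℝ Φ (ε⁻¹ • x)).det| * h x ∂μ)
        (𝓝[>] 0) (𝓝 (c * ∫ x, h x ∂μ)))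
    {h : E → ℝ} (hh : Integrable h μ) :
    Tendsto (fun ε : ℝ => ∫ x, g (Φinv (ε⁻¹ • x)) * h x ∂μ)
      (𝓝[>] 0) (𝓝 ((c / |L.det|) * ∫ x, h x ∂μ)) := by
  refine tendsto_integral_mul_of_forall_hasCompactSupport (C := C) (fun ε => ?_)
    (fun ε x => hC _) (fun k hk_cont hk_supp => ?_) hh
  · exact (hg.comp (hΦinv.continuous.measurable.comp
      (measurable_const_smul ε⁻¹))).aestronglyMeasurable
  obtain ⟨B, hB0, hB⟩ := hΦ.exists_abs_det_fderiv_le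
  have hC0 : 0 ≤ C := (abs_nonneg _).trans (hC 0)
  obtain ⟨A, hA⟩ := hk_supp.exists_bound_of_continuous hk_cont
  have hA0 : 0 ≤ A := (norm_nonneg _).trans (hA 0)
  obtain ⟨R, hR⟩ := hk_supp.isCompact.isBounded.subset_closedBall (0 : E)
  set ρ : ℝ := K' * R + ‖Φinv 0‖
  have hzero : ∀ ε : ℝ, 0 < ε → ε < 1 → ∀ x, ρ < ‖x‖ → k (ε • Φ (ε⁻¹ • x)) = 0 := by
    intro ε hε hε1 x hx
    by_contra hne
    have hmem : ‖ε • Φ (ε⁻¹ • x)‖ ≤ R :=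
      mem_closedBall_zero_iff.1 (hR (subset_tsupport k hne))
    have hdist : ‖ε⁻¹ • x - Φinv 0‖ ≤ K' * ‖Φ (ε⁻¹ • x)‖ := by
      simpa [dist_eq_norm, hleft _] using hΦinv.dist_le_mul (Φ (ε⁻¹ • x)) 0
    have hxe : ‖x‖ ≤ ε * (‖ε⁻¹ • x - Φinv 0‖ + ‖Φinv 0‖) := by
      calc ‖x‖ = ε * ‖ε⁻¹ • x‖ := by
            rw [norm_smul, norm_inv, Real.norm_of_nonneg hε.le, mul_inv_cancel_left₀ hε.ne']
        _ ≤ _ := by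
            gcongr
            exact norm_le_norm_sub_add _ _
    rw [norm_smul, Real.norm_of_nonneg hε.le] at hmem
    have : ‖x‖ ≤ ρ := by
      calc ‖x‖ ≤ ε * (K' * ‖Φ (ε⁻¹ • x)‖ + ‖Φinv 0‖) := hxe.trans (by gcongr)
        _ = K' * (ε * ‖Φ (ε⁻¹ • x)‖) + ε * ‖Φinv 0‖ := by ring
        _ ≤ K' * R + 1 * ‖Φinv 0‖ := by gcongr
        _ = ρ := by rw [one_mul]
    exact absurd hx this.not_gt
  have hmem : ∀ᶠ ε : ℝ in 𝓝[>] 0, 0 < ε ∧ ε < 1 := Ioo_mem_nhdsGT zero_lt_one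
  have hklim : ∀ x, Tendsto (fun ε : ℝ => k (ε • Φ (ε⁻¹ • x))) (𝓝[>] 0) (𝓝 (k (L x))) :=
    fun x => (hk_cont.tendsto _).comp (hconv x)
  have hkL_supp : ∀ x, ρ < ‖x‖ → k (L x) = 0 := fun x hx =>
    tendsto_nhds_unique (hklim x) <| tendsto_const_nhds.congr' <| by
      filter_upwards [hmem] with ε hε using (hzero ε hε.1 hε.2 x hx).symm
  have hkL_int : Integrable (fun x => k (L x)) μ := by
    refine (hk_cont.comp L.continuous).integrable_of_hasCompactSupport
      (HasCompactSupport.intro (isCompact_closedBall 0 ρ) fun x hx => hkL_supp x ?_)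
    simpa using hx
  have hkΦ_cont : ∀ ε : ℝ, Continuous fun x => k (ε • Φ (ε⁻¹ • x)) := fun ε => by
    have := hΦ.continuous
    fun_prop
  have hkΦ_int : ∀ ε : ℝ, 0 < ε → ε < 1 → Integrable (fun x => k (ε • Φ (ε⁻¹ • x))) μ :=
    fun ε hε hε1 => (hkΦ_cont ε).integrable_of_hasCompactSupport <|
      HasCompactSupport.intro (isCompact_closedBall 0 ρ) fun x hx =>
        hzero ε hε hε1 x (by simpa using hx)
  have hJ_meas : ∀ ε : ℝ,
      Measurable fun x => g (ε⁻¹ • x) * |(fderiv ℝ Φ (ε⁻¹ • x)).det| := fun ε =>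
    (hg.mul (ContinuousLinearMap.continuous_det.abs.measurable.comp
      (measurable_fderiv ℝ Φ))).comp (measurable_const_smul ε⁻¹)
  have hJ_bdd : ∀ (ε : ℝ) x, ‖g (ε⁻¹ • x) * |(fderiv ℝ Φ (ε⁻¹ • x)).det|‖ ≤ C * B := by
    intro ε x
    rw [norm_mul, Real.norm_eq_abs, Real.norm_eq_abs, abs_abs]
    exact mul_le_mul (hC _) (hB _) (abs_nonneg _) hC0
  have hdiff : Tendsto (fun ε : ℝ => ∫ x, g (ε⁻¹ • x) * |(fderiv ℝ Φ (ε⁻¹ • x)).det| *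
      (k (ε • Φ (ε⁻¹ • x)) - k (L x)) ∂μ) (𝓝[>] 0) (𝓝 0) := by
    suffices H : Tendsto (fun ε : ℝ => ∫ x, g (ε⁻¹ • x) * |(fderiv ℝ Φ (ε⁻¹ • x)).det| *
        (k (ε • Φ (ε⁻¹ • x)) - k (L x)) ∂μ) (𝓝[>] 0) (𝓝 (∫ _, 0 ∂μ)) by
      simpa only [integral_zero] using H
    refine tendsto_integral_filter_of_dominated_convergence
      ((closedBall (0 : E) ρ).indicator fun _ => C * B * (A + A)) ?_ ?_ ?_ ?_
    · exact Eventually.of_forall fun ε => ((hJ_meas ε).mul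
        ((hkΦ_cont ε).sub (hk_cont.comp L.continuous)).measurable).aestronglyMeasurable
    · filter_upwards [hmem] with ε hε
      refine Eventually.of_forall fun x => ?_
      by_cases hx : x ∈ closedBall (0 : E) ρ
      · rw [Set.indicator_of_mem hx, norm_mul]
        gcongr
        · exact hJ_bdd ε x
        · exact (norm_sub_le _ _).trans (add_le_add (hA _) (hA _))
      · have hx' : ρ < ‖x‖ := by simpa using hx
        rw [Set.indicator_of_notMem hx, hzero ε hε.1 hε.2 x hx', hkL_supp x hx']
        simp
    · exact (integrable_indicator_iff measurableSet_closedBall).2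
        (integrableOn_const measure_closedBall_lt_top.ne)
    · refine Eventually.of_forall fun x => ?_
      refine bdd_le_mul_tendsto_zero' (C * B) (Eventually.of_forall fun ε => hJ_bdd ε x) ?_
      simpa using (hklim x).sub_const (k (L x))
  have hchange : ∀ ε : ℝ, 0 < ε → ∫ y, g (Φinv (ε⁻¹ • y)) * k y ∂μ =
      ∫ x, g (ε⁻¹ • x) * |(fderiv ℝ Φ (ε⁻¹ • x)).det| * k (ε • Φ (ε⁻¹ • x)) ∂μ := by
    intro ε hε
    have hlip := (lipschitzWith_smul ε).comp (hΦ.comp (lipschitzWith_smul (β := E) ε⁻¹))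
    have hbij : Function.Bijective fun x : E => ε • Φ (ε⁻¹ • x) := by
      refine Function.bijective_iff_has_inverse.2 ⟨fun y => ε • Φinv (ε⁻¹ • y), ?_, ?_⟩
      · intro x
        simp [inv_smul_smul₀ hε.ne', smul_inv_smul₀ hε.ne', hleft _]
      · intro y
        simp [inv_smul_smul₀ hε.ne', smul_inv_smul₀ hε.ne', hright _]
    have hderiv : ∀ x, fderiv ℝ (fun x : E => ε • Φ (ε⁻¹ • x)) x = fderiv ℝ Φ (ε⁻¹ • x) := by
      intro x
      change fderiv ℝ (ε • fun x : E => Φ (ε⁻¹ • x)) x = _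
      rw [fderiv_const_smul_field, Pi.smul_apply, fderiv_comp_smul, smul_inv_smul₀ hε.ne']
    rw [LipschitzWith.integral_eq_integral_abs_det_fderiv_mul μ hlip hbij]
    refine integral_congr_ae (Eventually.of_forall fun x => ?_)
    have hx := hderiv x
    simp only [Function.comp_def] at hx ⊢
    rw [hx, inv_smul_smul₀ hε.ne', hleft]
    ring
  have hLk : ∫ x, k (L x) ∂μ = (∫ y, k y ∂μ) / |L.det| := by
    have hbij : Function.Bijective L :=
      (L.toContinuousLinearEquivOfDetNeZero hL).bijective
    rw [L.lipschitz.integral_eq_integral_abs_det_fderiv_mul μ hbij k]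
    simp only [ContinuousLinearMap.fderiv]
    rw [integral_const_mul, mul_div_cancel_left₀ _ (abs_ne_zero.2 hL)]
  have hlim := hdiff.add (hweak _ hkL_int)
  rw [hLk, zero_add, ← mul_div_assoc, ← div_mul_eq_mul_div] at hlim
  refine hlim.congr' ?_
  filter_upwards [hmem] with ε hε
  have hJ_ae : ∀ᵐ x ∂μ, ‖g (ε⁻¹ • x) * |(fderiv ℝ Φ (ε⁻¹ • x)).det|‖ ≤ C * B :=
    Eventually.of_forall (hJ_bdd ε)
  simp_rw [mul_sub]
  rw [hchange ε hε.1, integral_sub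
    ((hkΦ_int ε hε.1 hε.2).bdd_mul (hJ_meas ε).aestronglyMeasurable hJ_ae)
    (hkL_int.bdd_mul (hJ_meas ε).aestronglyMeasurable hJ_ae), sub_add_cancel]

/-- Deterministic core of Lemma 3: if `Φ` is a bi-Lipschitz bijection of `ℝ^d`,
`ε Φ(x/ε) → M x` locally uniformly for an invertible matrix `M`, `g` is bounded measurable,
and `x ↦ g(x/ε)|det DΦ(x/ε)|` converges weak-* in `L^∞` to the constant `c`, then
`x ↦ g(Φ⁻¹(x/ε))` converges weak-* in `L^∞` to the constant `c / |det M|`. -/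
theorem stmt_7 (d : ℕ)
    (Φ Φinv : EuclideanSpace ℝ (Fin d) → EuclideanSpace ℝ (Fin d))
    (hΦ_left : Function.LeftInverse Φinv Φ)
    (hΦ_right : Function.RightInverse Φinv Φ)
    (hΦ_lip : ∃ K : NNReal, LipschitzWith K Φ)
    (hΦinv_lip : ∃ K : NNReal, LipschitzWith K Φinv)
    (M : Matrix (Fin d) (Fin d) ℝ) (hM : M.det ≠ 0)
    (hconv : ∀ K : Set (EuclideanSpace ℝ (Fin d)), IsCompact K →
      TendstoUniformlyOn (fun (ε : ℝ) (x : EuclideanSpace ℝ (Fin d)) => ε • Φ (ε⁻¹ • x))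
        (fun x => Matrix.toEuclideanLin M x) (𝓝[>] (0 : ℝ)) K)
    (g : EuclideanSpace ℝ (Fin d) → ℝ) (hg_meas : Measurable g)
    (hg_bdd : ∃ C : ℝ, ∀ x, |g x| ≤ C)
    (c : ℝ)
    (hweak : ∀ h : EuclideanSpace ℝ (Fin d) → ℝ, Integrable h →
      Tendsto (fun ε : ℝ => ∫ x, g (ε⁻¹ • x) * |(fderiv ℝ Φ (ε⁻¹ • x)).det| * h x)
        (𝓝[>] (0 : ℝ)) (𝓝 (c * ∫ x, h x))) :
    ∀ h : EuclideanSpace ℝ (Fin d) → ℝ, Integrable h →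
      Tendsto (fun ε : ℝ => ∫ x, g (Φinv (ε⁻¹ • x)) * h x)
        (𝓝[>] (0 : ℝ)) (𝓝 ((c / |M.det|) * ∫ x, h x)) := by
  obtain ⟨K, hK⟩ := hΦ_lip
  obtain ⟨K', hK'⟩ := hΦinv_lip
  obtain ⟨C, hC⟩ := hg_bdd
  intro h hh
  set L : EuclideanSpace ℝ (Fin d) →L[ℝ] EuclideanSpace ℝ (Fin d) :=
    LinearMap.toContinuousLinearMap (Matrix.toEuclideanLin M)
  have hdet : L.det = M.det := by
    change LinearMap.det (Matrix.toLpLin 2 2 M) = M.det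
    rw [Matrix.toLpLin_eq_toLin, LinearMap.det_toLin]
  rw [← hdet]
  refine tendsto_integral_comp_inverse_mul volume hΦ_left hΦ_right hK hK' (hdet ▸ hM)
    (fun x => ?_) hg_meas hC hweak hh
  exact (hconv {x} isCompact_singleton).tendsto_at (Set.mem_singleton x)
end
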